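/- For every real sequence v_0, v_1, …, v_N and every 1 ≤ m ≤ N one has the telescoping identity Σ_{n=1}^{m} P^{(m)}_{m−n} Σ_{k=1}^{n} a^{(n)}_{n−k} (v_k − v_{k−1}) = v_m − v_0. -/

import Mathlib

/-- The complementary kernel `P` of `a` satisfies `∑ j ∈ [k, m], P m (m - j) * a j (j - k) = 1`. -/
theorem sum_complementary_kernel_mul_eq_one {K : Type*} [Field K] {N : ℕ} {a P : ℕ → ℕ → K}
    (ha : ∀ k, 1 ≤ k → k ≤ N → a k 0 ≠ 0)
    (hP0 : ∀ n : ℕ, 1 ≤ n → n ≤ N → P n 0 = 1 / a n 0)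
    (hPrec : ∀ n k : ℕ, 1 ≤ k → k ≤ n - 1 → n ≤ N →
      P n (n - k) = (1 / a k 0) *
        ∑ j ∈ Finset.Icc (k + 1) n, (a j (j - k - 1) - a j (j - k)) * P n (n - j))
    {m k : ℕ} (hk : 1 ≤ k) (hkm : k ≤ m) (hm : m ≤ N) :
    ∑ j ∈ Finset.Icc k m, P m (m - j) * a j (j - k) = 1 := by
  induction hd : m - k generalizing k with
  | zero =>
    obtain rfl : k = m := by lia
    simp [hP0 k hk hm, ha k hk hm]
  | succ d ih =>
    rw [← ih (k := k + 1) (by lia) (by lia) (by lia), ← Finset.add_sum_Ioc_eq_sum_Icc hkm,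
      hPrec m k hk (by lia) hm, Nat.sub_self, one_div, mul_comm, ← mul_assoc,
      mul_inv_cancel₀ (ha k hk (by lia)), one_mul, ← Finset.Icc_add_one_left_eq_Ioc,
      ← Finset.sum_add_distrib]
    refine Finset.sum_congr rfl fun j _ ↦ ?_
    rw [Nat.sub_sub]
    ring

/-- Telescoping over a closed interval of natural numbers. -/
theorem sum_Icc_one_sub_pred {G : Type*} [AddCommGroup G] (v : ℕ → G) (m : ℕ) :
    ∑ k ∈ Finset.Icc 1 m, (v k - v (k - 1)) = v m - v 0 := by
  induction m with
  | zero => simp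
  | succ m ih => rw [Finset.sum_Icc_succ_top (by lia), ih]; simp


/-- For every real sequence `v_0, v_1, …, v_N` and every `1 ≤ m ≤ N`
one has the telescoping identity
`Σ_{n=1}^{m} P^{(m)}_{m−n} Σ_{k=1}^{n} a^{(n)}_{n−k} (v_k − v_{k−1}) = v_m − v_0`. -/
theorem complementary_kernel_telescoping
    (σ T : ℝ) (hσ0 : 0 < σ) (hσ1 : σ < 1) (hT : 0 < T)
    (N : ℕ) (hN : 1 ≤ N)
    (t : ℕ → ℝ) (ht0 : t 0 = 0)
    (htmono : ∀ k < N, t k < t (k + 1)) (htT : t N ≤ T)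
    (a : ℕ → ℕ → ℝ)
    (ha : ∀ n k : ℕ, 1 ≤ k → k ≤ n → n ≤ N →
      a n (n - k) =
        ((t n - t (k - 1)) ^ (1 - σ) / Real.Gamma (2 - σ)
          - (t n - t k) ^ (1 - σ) / Real.Gamma (2 - σ)) / (t k - t (k - 1)))
    (P : ℕ → ℕ → ℝ)
    (hP0 : ∀ n : ℕ, 1 ≤ n → n ≤ N → P n 0 = 1 / a n 0)
    (hPrec : ∀ n k : ℕ, 1 ≤ k → k ≤ n - 1 → n ≤ N →
      P n (n - k) = (1 / a k 0) *
        ∑ j ∈ Finset.Icc (k + 1) n, (a j (j - k - 1) - a j (j - k)) * P n (n - j)) :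
    ∀ v : ℕ → ℝ, ∀ m : ℕ, 1 ≤ m → m ≤ N →
      ∑ n ∈ Finset.Icc 1 m, P m (m - n) *
        ∑ k ∈ Finset.Icc 1 n, a n (n - k) * (v k - v (k - 1)) = v m - v 0 := by
  intro v m _ hmN
  have ha_ne : ∀ k, 1 ≤ k → k ≤ N → a k 0 ≠ 0 := by
    intro k hk hkN
    have hstep : 0 < t k - t (k - 1) := by
      have h := htmono (k - 1) (by lia)
      rw [Nat.sub_add_cancel hk] at h
      exact sub_pos.mpr h
    have hΓ : 0 < Real.Gamma (2 - σ) := Real.Gamma_pos_of_pos (by linarith)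
    have h := ha k k hk le_rfl hkN
    rw [Nat.sub_self, sub_self, Real.zero_rpow (by linarith), zero_div, sub_zero] at h
    rw [h]
    positivity
  simp_rw [Finset.mul_sum]
  rw [Finset.sum_comm' (t' := Finset.Icc 1 m) (s' := fun k ↦ Finset.Icc k m)
    (by intro n k; simp only [Finset.mem_Icc]; lia), ← sum_Icc_one_sub_pred v m]
  refine Finset.sum_congr rfl fun k hk ↦ ?_
  obtain ⟨hk1, hkm⟩ := Finset.mem_Icc.mp hk
  simp_rw [← mul_assoc]
  rw [← Finset.sum_mul, sum_complementary_kernel_mul_eq_one ha_ne hP0 hPrec hk1 hkm hmN, one_mul]
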